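/- Let E be a finite-dimensional real inner product space, n ∈ ℕ, and let w : ℝ → (Fin n → E) be a C^∞ (infinitely differentiable) map such that for every t ∈ ℝ the family w(t) = (w₁(t), …, w_n(t)) is linearly independent. Then the map t ↦ gramSchmidtNormed(w(t)), assigning to t the orthonormal family obtained from w(t) by the Gram–Schmidt orthonormalization procedure, is C^∞; in particular each vector of the resulting orthonormal family depends smoothly on t. -/

import Mathlib

namespace InnerProductSpace

variable {F E ι : Type*} [NormedAddCommGroup F] [NormedSpace ℝ F]
  [NormedAddCommGroup E] [InnerProductSpace ℝ E]
  [LinearOrder ι] [LocallyFiniteOrderBot ι] [WellFoundedLT ι] {k : WithTop ℕ∞} {w : F → ι → E}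

theorem contDiff_gramSchmidt (hw : ∀ i, ContDiff ℝ k fun t => w t i)
    (hli : ∀ t, LinearIndependent ℝ (w t)) (i : ι) :
    ContDiff ℝ k fun t => gramSchmidt ℝ (w t) i := by
  induction i using WellFoundedLT.induction with
  | ind i ih =>
    simp only [gramSchmidt_def ℝ _ i, Submodule.starProjection_singleton]
    refine (hw i).sub (ContDiff.sum fun j hj => ?_)
    have hj := ih j (Finset.mem_Iio.1 hj)
    have hne t : gramSchmidt ℝ (w t) j ≠ 0 := gramSchmidt_ne_zero j (hli t)
    refine ContDiff.smul (ContDiff.div (hj.inner ℝ (hw i)) ?_ fun t => ?_) hj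
    · exact (hj.norm ℝ hne).pow 2
    · simpa using hne t

theorem contDiff_gramSchmidtNormed (hw : ∀ i, ContDiff ℝ k fun t => w t i)
    (hli : ∀ t, LinearIndependent ℝ (w t)) (i : ι) :
    ContDiff ℝ k fun t => gramSchmidtNormed ℝ (w t) i := by
  have hi := contDiff_gramSchmidt hw hli i
  have hne t : gramSchmidt ℝ (w t) i ≠ 0 := gramSchmidt_ne_zero i (hli t)
  exact ((hi.norm ℝ hne).inv fun t => norm_ne_zero_iff.2 (hne t)).smul hi

end InnerProductSpace


/-- if `w : ℝ → (Fin n → E)` is a `C^∞` family of vectors in a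
finite-dimensional real inner product space such that `w t` is linearly independent for
every `t`, then `t ↦ gramSchmidtNormed ℝ (w t)` is `C^∞`; in particular each vector of the
resulting orthonormal family depends smoothly on `t`. -/
theorem gramSchmidtNormed_smooth_dependence
    {E : Type*} [NormedAddCommGroup E] [InnerProductSpace ℝ E] [FiniteDimensional ℝ E]
    (n : ℕ) (w : ℝ → Fin n → E)
    (hw : ContDiff ℝ (⊤ : ℕ∞) w)
    (hli : ∀ t : ℝ, LinearIndependent ℝ (w t)) :
    ContDiff ℝ (⊤ : ℕ∞) (fun t =>
      @InnerProductSpace.gramSchmidtNormed ℝ _ _ _ _ (Fin n) _ _ (inferInstance : WellFoundedLT (Fin n)) (w t)) ∧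
    ∀ i : Fin n, ContDiff ℝ (⊤ : ℕ∞) (fun t =>
      @InnerProductSpace.gramSchmidtNormed ℝ _ _ _ _ (Fin n) _ _ (inferInstance : WellFoundedLT (Fin n)) (w t) i) := by
  have h := InnerProductSpace.contDiff_gramSchmidtNormed (contDiff_pi.1 hw) hli
  exact ⟨contDiff_pi.2 h, h⟩
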